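/- (First-order hydrostatic sensitivity.) Let K > 0 and η ∈ ℝ. Define the three functions of d_H: K̃_tri(d_H) = K(1 − d_H)/(1 − (1 − η)d_H) on [0, 1), K̃_uni(d_H) = 5K(1 − 3d_H)/[5 − (15 − 8η)d_H − 2η(1 − √(1 − 3d_H))] on [0, 1/3), and K̃_bi(d_H) = 5K(2 − 3d_H)/[10 − (15 − 13η)d_H − 2η(2 − √(4 − 6d_H))] on [0, 2/3). Then each of these three functions takes the value K at d_H = 0 and has derivative −ηK at d_H = 0; that is, in all three loading cases K̃ = K(1 − η d_H) + O(d_H²) as d_H → 0⁺. -/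

import Mathlib

open Filter

/-- **First-order hydrostatic sensitivity.** The effective bulk moduli in equi-triaxial,
uniaxial and equi-biaxial tension all take the value `K` at `d_H = 0` and have (one-sided)
derivative `−ηK` at `d_H = 0`; that is, `K̃ = K(1 − η d_H) + O(d_H²)` as `d_H → 0⁺` in all
three loading cases. -/
theorem first_order_hydrostatic_sensitivity (K η : ℝ) (hK : 0 < K)
    (Ktri Kuni Kbi : ℝ → ℝ)
    (htri : ∀ d, Ktri d = K * (1 - d) / (1 - (1 - η) * d))
    (huni : ∀ d, Kuni d = 5 * K * (1 - 3 * d) /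
      (5 - (15 - 8 * η) * d - 2 * η * (1 - Real.sqrt (1 - 3 * d))))
    (hbi : ∀ d, Kbi d = 5 * K * (2 - 3 * d) /
      (10 - (15 - 13 * η) * d - 2 * η * (2 - Real.sqrt (4 - 6 * d)))) :
    Ktri 0 = K ∧ Kuni 0 = K ∧ Kbi 0 = K ∧
      HasDerivWithinAt Ktri (-(η * K)) (Set.Ici 0) 0 ∧
      HasDerivWithinAt Kuni (-(η * K)) (Set.Ici 0) 0 ∧
      HasDerivWithinAt Kbi (-(η * K)) (Set.Ici 0) 0 := by
  have hlin (a c : ℝ) : HasDerivAt (fun d : ℝ => a - c * d) (-c) 0 := by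
    simpa using ((hasDerivAt_id (0 : ℝ)).const_mul c).const_sub a
  have h4 : Real.sqrt 4 = 2 := by
    rw [show (4 : ℝ) = 2 ^ 2 by norm_num, Real.sqrt_sq (by norm_num)]
  obtain rfl : Ktri = _ := funext htri
  obtain rfl : Kuni = _ := funext huni
  obtain rfl : Kbi = _ := funext hbi
  refine ⟨by simp, ?_, ?_, ?_, ?_, ?_⟩
  · norm_num
  · norm_num [h4]
    field_simp
    norm_num
  · have hn := (by simpa using hlin 1 1 : HasDerivAt (fun d : ℝ => 1 - d) (-1) 0).const_mul K
    refine ((hn.fun_div (hlin 1 (1 - η)) (by simp)).congr_deriv ?_).hasDerivWithinAt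
    norm_num
    ring
  · have hs := (hlin 1 3).sqrt (by norm_num)
    have hd := (hlin 5 (15 - 8 * η)).fun_sub ((hs.const_sub 1).const_mul (2 * η))
    have hn := (hlin 1 3).const_mul (5 * K)
    refine ((hn.fun_div hd (by norm_num)).congr_deriv ?_).hasDerivWithinAt
    norm_num
    ring
  · have hs := (hlin 4 6).sqrt (by norm_num)
    have hd := (hlin 10 (15 - 13 * η)).fun_sub ((hs.const_sub 2).const_mul (2 * η))
    have hn := (hlin 2 3).const_mul (5 * K)
    refine ((hn.fun_div hd (by norm_num [h4])).congr_deriv ?_).hasDerivWithinAt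
    norm_num [h4]
    ring
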